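/- arXiv:2002.06118 — 6 statements merged into one kernel-verified Lean document; each statement's English description precedes it below -/
import Mathlib

section
/- Let δ > 0 and x ∈ ℝ, and let ξ be a real random variable uniformly distributed on [-δ, δ]. Set η = (ξ - x)². Then the third central moment satisfies E[(η - E[η])³] = (16δ⁴/15)·(x² + δ²/63). -/
open MeasureTheory

/-- The expectation of a continuous function of a variable uniform on `[-δ, δ]`. -/
theorem integral_comp_of_map_eq_uniform {Ω : Type*} [MeasurableSpace Ω] {μ : Measure Ω}
    {δ : ℝ} (hδ : 0 < δ) {ξ : Ω → ℝ} (hξm : Measurable ξ)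
    (hξ : Measure.map ξ μ =
      (volume (Set.Icc (-δ) δ))⁻¹ • volume.restrict (Set.Icc (-δ) δ))
    {f : ℝ → ℝ} (hf : Continuous f) :
    ∫ ω, f (ξ ω) ∂μ = (2 * δ)⁻¹ * ∫ u in -δ..δ, f u := by
  rw [← integral_map hξm.aemeasurable hf.aestronglyMeasurable, hξ, integral_smul_measure,
    integral_Icc_eq_integral_Ioc, ← intervalIntegral.integral_of_le (by linarith),
    Real.volume_Icc, ENNReal.toReal_inv, ENNReal.toReal_ofReal (by linarith), smul_eq_mul,
    sub_neg_eq_add, ← two_mul]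

theorem integral_sq_sub_pow_three (a b c : ℝ) :
    ∫ v in a..b, (v ^ 2 - c) ^ 3 =
      (b ^ 7 / 7 - 3 * c * b ^ 5 / 5 + c ^ 2 * b ^ 3 - c ^ 3 * b) -
        (a ^ 7 / 7 - 3 * c * a ^ 5 / 5 + c ^ 2 * a ^ 3 - c ^ 3 * a) := by
  refine intervalIntegral.integral_eq_sub_of_hasDerivAt
    (f := fun v : ℝ => v ^ 7 / 7 - 3 * c * v ^ 5 / 5 + c ^ 2 * v ^ 3 - c ^ 3 * v)
    (fun v _ => ?_) (Continuous.intervalIntegrable (by fun_prop) _ _)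
  convert (((((hasDerivAt_pow 7 v).div_const 7).sub
    (((hasDerivAt_pow 5 v).const_mul (3 * c)).div_const 5)).add
    ((hasDerivAt_pow 3 v).const_mul (c ^ 2))).sub ((hasDerivAt_id v).const_mul (c ^ 3))) using 1
  · rfl
  · push_cast
    ring

/-- Let `δ > 0`, `x ∈ ℝ`, and let `ξ` be uniformly distributed on `[-δ, δ]`.
With `η = (ξ - x)²`, the third central moment is
`E[(η - E[η])³] = (16δ⁴/15)·(x² + δ²/63)`. -/
theorem stmt_3 {Ω : Type*} [MeasurableSpace Ω] (μ : Measure Ω) [IsProbabilityMeasure μ]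
    (δ x : ℝ) (hδ : 0 < δ) (ξ : Ω → ℝ) (hξm : Measurable ξ)
    (hξ : Measure.map ξ μ =
      (volume (Set.Icc (-δ) δ))⁻¹ • volume.restrict (Set.Icc (-δ) δ)) :
    (∫ ω, ((ξ ω - x) ^ 2 - ∫ ω', (ξ ω' - x) ^ 2 ∂μ) ^ 3 ∂μ)
      = (16 * δ ^ 4 / 15) * (x ^ 2 + δ ^ 2 / 63) := by
  rw [integral_comp_of_map_eq_uniform hδ hξm hξ (f := fun u => (u - x) ^ 2) (by fun_prop),
    integral_comp_of_map_eq_uniform hδ hξm hξ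
      (f := fun u => ((u - x) ^ 2 - (2 * δ)⁻¹ * ∫ u in -δ..δ, (u - x) ^ 2) ^ 3) (by fun_prop),
    intervalIntegral.integral_comp_sub_right (fun v => v ^ 2), integral_pow]
  have hmean : (2 * δ)⁻¹ * (((δ - x) ^ (2 + 1) - (-δ - x) ^ (2 + 1)) / ((2 : ℕ) + 1)) =
      x ^ 2 + δ ^ 2 / 3 := by
    push_cast
    field_simp
    ring
  rw [hmean, intervalIntegral.integral_comp_sub_right (fun v => (v ^ 2 - (x ^ 2 + δ ^ 2 / 3)) ^ 3),
    integral_sq_sub_pow_three]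
  field_simp
  ring
end

section
/- Let δ > 0 and x ∈ ℝ, and let ξ be a real random variable uniformly distributed on [-δ, δ]. Set η = (ξ - x)². Then the fourth central moment satisfies E[(η - E[η])⁴] = 3 · E[η] · E[(η - E[η])³]; explicitly, E[(η - E[η])⁴] = 3 · (x² + δ²/3) · (16δ⁴/15) · (x² + δ²/63). -/
open MeasureTheory

/-- The expectation of a continuous function of a uniform variable on `[-δ, δ]`. -/
theorem integral_comp_of_uniform_symm {Ω : Type*} [MeasurableSpace Ω] {μ : Measure Ω}
    {δ : ℝ} (hδ : 0 < δ) {ξ : Ω → ℝ} (hξm : Measurable ξ)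
    (hξ : Measure.map ξ μ =
      (volume (Set.Icc (-δ) δ))⁻¹ • volume.restrict (Set.Icc (-δ) δ))
    {f : ℝ → ℝ} (hf : Continuous f) :
    ∫ ω, f (ξ ω) ∂μ = (2 * δ)⁻¹ * ∫ t in (-δ)..δ, f t := by
  rw [← integral_map hξm.aemeasurable hf.aestronglyMeasurable, hξ, integral_smul_measure,
    intervalIntegral.integral_of_le (by linarith), integral_Icc_eq_integral_Ioc, Real.volume_Icc,
    ENNReal.toReal_inv, ENNReal.toReal_ofReal (by linarith), smul_eq_mul]
  ring_nf

/-- The expectation of a polynomial in a uniform variable on `[-δ, δ]`. -/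
theorem integral_sum_pow_of_uniform_symm {Ω : Type*} [MeasurableSpace Ω] {μ : Measure Ω}
    {δ : ℝ} (hδ : 0 < δ) {ξ : Ω → ℝ} (hξm : Measurable ξ)
    (hξ : Measure.map ξ μ =
      (volume (Set.Icc (-δ) δ))⁻¹ • volume.restrict (Set.Icc (-δ) δ))
    {n : ℕ} (c : Fin n → ℝ) :
    ∫ ω, ∑ i, c i * ξ ω ^ (i : ℕ) ∂μ =
      (2 * δ)⁻¹ * ∑ i, c i * ((δ ^ ((i : ℕ) + 1) - (-δ) ^ ((i : ℕ) + 1)) / ((i : ℕ) + 1)) := by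
  rw [integral_comp_of_uniform_symm hδ hξm hξ (f := fun t ↦ ∑ i, c i * t ^ (i : ℕ))
    (by fun_prop), intervalIntegral.integral_finsetSum
    fun i _ ↦ (by fun_prop : Continuous fun t : ℝ ↦ c i * t ^ (i : ℕ)).intervalIntegrable _ _]
  simp only [intervalIntegral.integral_const_mul, integral_pow]

/-- Let `δ > 0`, `x ∈ ℝ`, and let `ξ` be uniformly distributed on `[-δ, δ]`.
With `η = (ξ - x)²`, the fourth central moment satisfies
`E[(η - E[η])⁴] = 3 · E[η] · E[(η - E[η])³]`; explicitly,
`E[(η - E[η])⁴] = 3 · (x² + δ²/3) · (16δ⁴/15) · (x² + δ²/63)`. -/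
theorem stmt_4 {Ω : Type*} [MeasurableSpace Ω] (μ : Measure Ω) [IsProbabilityMeasure μ]
    (δ x : ℝ) (hδ : 0 < δ) (ξ : Ω → ℝ) (hξm : Measurable ξ)
    (hξ : Measure.map ξ μ =
      (volume (Set.Icc (-δ) δ))⁻¹ • volume.restrict (Set.Icc (-δ) δ)) :
    (∫ ω, ((ξ ω - x) ^ 2 - ∫ ω', (ξ ω' - x) ^ 2 ∂μ) ^ 4 ∂μ)
        = 3 * (∫ ω, (ξ ω - x) ^ 2 ∂μ)
            * (∫ ω, ((ξ ω - x) ^ 2 - ∫ ω', (ξ ω' - x) ^ 2 ∂μ) ^ 3 ∂μ) ∧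
    (∫ ω, ((ξ ω - x) ^ 2 - ∫ ω', (ξ ω' - x) ^ 2 ∂μ) ^ 4 ∂μ)
        = 3 * (x ^ 2 + δ ^ 2 / 3) * (16 * δ ^ 4 / 15) * (x ^ 2 + δ ^ 2 / 63) := by
  have mean : ∫ ω, (ξ ω - x) ^ 2 ∂μ = x ^ 2 + δ ^ 2 / 3 := by
    have h := integral_sum_pow_of_uniform_symm hδ hξm hξ ![x ^ 2, -2 * x, 1]
    simp [Fin.sum_univ_succ] at h
    convert h using 1
    · congr 1 with ω
      ring
    · field_simp
      ring
  have third : ∫ ω, ((ξ ω - x) ^ 2 - (x ^ 2 + δ ^ 2 / 3)) ^ 3 ∂μ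
      = (16 * δ ^ 4 / 15) * (x ^ 2 + δ ^ 2 / 63) := by
    obtain ⟨a, ha⟩ : ∃ a, a = δ ^ 2 / 3 := ⟨_, rfl⟩
    have h := integral_sum_pow_of_uniform_symm hδ hξm hξ
      ![-a ^ 3, -6 * a ^ 2 * x, 3 * a ^ 2 - 12 * a * x ^ 2, -8 * x ^ 3 + 12 * a * x,
        12 * x ^ 2 - 3 * a, -6 * x, 1]
    simp [Fin.sum_univ_succ] at h
    rw [← ha]
    convert h using 1
    · congr 1 with ω
      ring
    · rw [ha]
      field_simp
      ring
  have fourth : ∫ ω, ((ξ ω - x) ^ 2 - (x ^ 2 + δ ^ 2 / 3)) ^ 4 ∂μ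
      = 3 * (x ^ 2 + δ ^ 2 / 3) * (16 * δ ^ 4 / 15) * (x ^ 2 + δ ^ 2 / 63) := by
    obtain ⟨a, ha⟩ : ∃ a, a = δ ^ 2 / 3 := ⟨_, rfl⟩
    have h := integral_sum_pow_of_uniform_symm hδ hξm hξ
      ![a ^ 4, 8 * a ^ 3 * x, -4 * a ^ 3 + 24 * a ^ 2 * x ^ 2, -24 * a ^ 2 * x + 32 * a * x ^ 3,
        6 * a ^ 2 - 48 * a * x ^ 2 + 16 * x ^ 4, 24 * a * x - 32 * x ^ 3, -4 * a + 24 * x ^ 2,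
        -8 * x, 1]
    simp [Fin.sum_univ_succ] at h
    rw [← ha]
    convert h using 1
    · congr 1 with ω
      ring
    · rw [ha]
      field_simp
      ring
  rw [mean, third, fourth]
  exact ⟨by ring, rfl⟩
end

section
/- Let d ≥ 1 and Z ∈ ℝ^d, and let U be a random vector uniformly distributed on C_d = [-1,1]^d. Then the third central moment of ‖U - Z‖² satisfies E[(‖U - Z‖² - E[‖U - Z‖²])³] = (16/15)·(‖Z‖² + d/63), where ‖·‖ is the Euclidean norm on ℝ^d. -/
open MeasureTheory

/-- The third moment is additive over sums of independent, centered, bounded random variables. -/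
lemma integral_sum_pow_three_of_iIndepFun {ι Ω : Type*} [MeasurableSpace Ω] {μ : Measure Ω}
    [IsProbabilityMeasure μ] {X : ι → Ω → ℝ} (hX : ProbabilityTheory.iIndepFun X μ)
    (hm : ∀ i, AEMeasurable (X i) μ) (hb : ∀ i, MemLp (X i) ⊤ μ)
    (h0 : ∀ i, ∫ ω, X i ω ∂μ = 0) (s : Finset ι) :
    ∫ ω, (∑ i ∈ s, X i ω) ^ 3 ∂μ = ∑ i ∈ s, ∫ ω, X i ω ^ 3 ∂μ := by
  classical
  induction s using Finset.induction_on with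
  | empty => simp
  | insert a s ha ih =>
    have hind : ProbabilityTheory.IndepFun (fun ω ↦ ∑ i ∈ s, X i ω) (X a) μ := by
      have h := hX.indepFun_finsetSum_of_notMem₀ hm ha
      rwa [Finset.sum_fn] at h
    have hS : MemLp (fun ω ↦ ∑ i ∈ s, X i ω) ⊤ μ := memLp_finsetSum s fun i _ ↦ hb i
    have hA := hb a
    have hS0 : ∫ ω, ∑ i ∈ s, X i ω ∂μ = 0 := by
      rw [integral_finsetSum s fun i _ ↦ (hb i).integrable le_top]
      simp [h0]
    simp only [Finset.sum_insert ha]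
    rw [← ih]
    set S : Ω → ℝ := fun ω ↦ ∑ i ∈ s, X i ω
    have hSS : MemLp (fun ω ↦ S ω ^ 2) ⊤ μ := by simpa only [sq] using hS.mul' hS
    have hAA : MemLp (fun ω ↦ X a ω ^ 2) ⊤ μ := by simpa only [sq] using hA.mul' hA
    have hSSS : MemLp (fun ω ↦ S ω ^ 3) ⊤ μ := by simpa only [pow_succ _ 2] using hS.mul' hSS
    have hAAA : MemLp (fun ω ↦ X a ω ^ 3) ⊤ μ := by simpa only [pow_succ _ 2] using hA.mul' hAA
    have hSSA : ∫ ω, S ω ^ 2 * X a ω ∂μ = 0 := by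
      have h := (hind.comp (measurable_id.pow_const 2) measurable_id
        ).integral_fun_mul_eq_mul_integral hSS.aestronglyMeasurable hA.aestronglyMeasurable
      simpa [h0] using h
    have hSAA : ∫ ω, S ω * X a ω ^ 2 ∂μ = 0 := by
      have h := (hind.comp measurable_id (measurable_id.pow_const 2)
        ).integral_fun_mul_eq_mul_integral hS.aestronglyMeasurable hAA.aestronglyMeasurable
      simpa [hS0] using h
    have hi₁ : Integrable (fun ω ↦ S ω ^ 2 * X a ω) μ := (hA.mul' (r := ⊤) hSS).integrable le_top
    have hi₂ : Integrable (fun ω ↦ S ω * X a ω ^ 2) μ := (hAA.mul' (r := ⊤) hS).integrable le_top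
    calc ∫ ω, (X a ω + S ω) ^ 3 ∂μ
        = ∫ ω, X a ω ^ 3 + S ω ^ 3 + 3 * (S ω ^ 2 * X a ω) + 3 * (S ω * X a ω ^ 2) ∂μ := by
          congr with ω
          ring
      _ = _ := by
          have hc : Integrable (fun ω ↦ X a ω ^ 3 + S ω ^ 3) μ :=
            (hAAA.integrable le_top).add (hSSS.integrable le_top)
          have hc' : Integrable (fun ω ↦ X a ω ^ 3 + S ω ^ 3 + 3 * (S ω ^ 2 * X a ω)) μ :=
            hc.add (hi₁.const_mul 3)
          rw [integral_add hc' (hi₂.const_mul 3),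
            integral_add hc (hi₁.const_mul 3),
            integral_add (hAAA.integrable le_top) (hSSS.integrable le_top),
            integral_const_mul, integral_const_mul, hSSA, hSAA]
          simp [S]

/-- The uniform probability measure on `[-1, 1]`. -/
noncomputable def uniformIcc : Measure ℝ :=
  (2 : ENNReal)⁻¹ • volume.restrict (Set.Icc (-1) 1)

instance : IsProbabilityMeasure uniformIcc := by
  constructor
  simp only [uniformIcc, Measure.smul_apply, Measure.restrict_apply_univ, Real.volume_Icc,
    smul_eq_mul]
  norm_num
  exact ENNReal.inv_mul_cancel (by simp) (by simp)

lemma integral_uniformIcc (f : ℝ → ℝ) :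
    ∫ x, f x ∂uniformIcc = 2⁻¹ * ∫ x in (-1 : ℝ)..1, f x := by
  rw [uniformIcc, integral_smul_measure, intervalIntegral.integral_of_le (by norm_num),
    integral_Icc_eq_integral_Ioc]
  simp

lemma memLp_top_uniformIcc {f : ℝ → ℝ} (hf : Continuous f) : MemLp f ⊤ uniformIcc := by
  obtain ⟨C, hC⟩ := (isCompact_Icc (a := (-1 : ℝ)) (b := 1)).exists_bound_of_continuousOn
    hf.continuousOn
  refine memLp_top_of_bound hf.aestronglyMeasurable C ?_
  exact Measure.ae_smul_measure ((ae_restrict_iff' measurableSet_Icc).2 (.of_forall hC)) _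

lemma integral_sq_sub_uniformIcc (z : ℝ) : ∫ x, (x - z) ^ 2 ∂uniformIcc = 1 / 3 + z ^ 2 := by
  rw [integral_uniformIcc, intervalIntegral.integral_comp_sub_right (fun x ↦ x ^ 2)]
  rw [integral_pow]
  norm_num
  ring

lemma integral_centered_sq_sub_pow_three_uniformIcc (z : ℝ) :
    ∫ x, ((x - z) ^ 2 - (1 / 3 + z ^ 2)) ^ 3 ∂uniformIcc = 16 / 15 * (z ^ 2 + 1 / 63) := by
  have hderiv (x : ℝ) : HasDerivAt (fun x : ℝ ↦ x ^ 7 / 7 - z * x ^ 6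
      + (12 * z ^ 2 - 1) * x ^ 5 / 5 + (4 * z - 8 * z ^ 3) * x ^ 4 / 4
      + (1 / 3 - 4 * z ^ 2) * x ^ 3 / 3 - z * x ^ 2 / 3 - x / 27)
      (((x - z) ^ 2 - (1 / 3 + z ^ 2)) ^ 3) x := by
    have h (n : ℕ) := hasDerivAt_pow n x
    refine HasDerivAt.congr_deriv ((((((((h 7).div_const 7).sub ((h 6).const_mul z)).add
      (((h 5).const_mul _).div_const 5)).add (((h 4).const_mul _).div_const 4)).add
      (((h 3).const_mul _).div_const 3)).sub (((h 2).const_mul z).div_const 3)).sub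
      ((hasDerivAt_id x).div_const 27)) ?_
    push_cast
    ring
  rw [integral_uniformIcc, intervalIntegral.integral_eq_sub_of_hasDerivAt (fun x _ ↦ hderiv x)
    (Continuous.intervalIntegrable (by fun_prop) _ _)]
  ring

/-- A random vector uniform on the cube has independent coordinates uniform on `[-1, 1]`. -/
lemma map_ofLp_uniform_cube (d : ℕ) :
    Measure.map (WithLp.ofLp : EuclideanSpace ℝ (Fin d) → Fin d → ℝ)
      ((volume {y : EuclideanSpace ℝ (Fin d) | ∀ i, |y i| ≤ 1})⁻¹ •
        volume.restrict {y : EuclideanSpace ℝ (Fin d) | ∀ i, |y i| ≤ 1})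
      = Measure.pi fun _ ↦ uniformIcc := by
  have hvp := PiLp.volume_preserving_ofLp (Fin d)
  set C : Set (Fin d → ℝ) := Set.univ.pi fun _ ↦ Set.Icc (-1) 1
  have hC : MeasurableSet C := .univ_pi fun _ ↦ measurableSet_Icc
  have hpre : {y : EuclideanSpace ℝ (Fin d) | ∀ i, |y i| ≤ 1} = WithLp.ofLp ⁻¹' C := by
    ext y
    simp only [C, Set.mem_ofPred_eq, Set.mem_preimage, Set.mem_univ_pi, Set.mem_Icc, abs_le]
  rw [hpre, hvp.measure_preimage hC.nullMeasurableSet, Measure.map_smul,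
    (hvp.restrict_preimage hC).map_eq]
  refine (Measure.pi_eq fun s hs ↦ ?_).symm
  rw [Measure.smul_apply, Measure.restrict_apply (.univ_pi hs), ← Set.pi_inter_distrib,
    volume_pi_pi, volume_pi_pi]
  simp only [uniformIcc, Measure.smul_apply, Measure.restrict_apply (hs _), smul_eq_mul,
    Finset.prod_mul_distrib, Real.volume_Icc, Finset.prod_const]
  norm_num [ENNReal.inv_pow]

/-- Let `d ≥ 1`, `Z ∈ ℝ^d`, and let `U` be uniformly distributed on the
cube `C_d = [-1,1]^d`. Then the third central moment of `‖U - Z‖²` is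
`E[(‖U - Z‖² - E[‖U - Z‖²])³] = (16/15)·(‖Z‖² + d/63)` (Euclidean norm). -/
theorem stmt_9 (d : ℕ) (hd : 1 ≤ d) (Z : EuclideanSpace ℝ (Fin d))
    {Ω : Type*} [MeasurableSpace Ω] (μ : Measure Ω) [IsProbabilityMeasure μ]
    (U : Ω → EuclideanSpace ℝ (Fin d)) (hUm : Measurable U)
    (hU : Measure.map U μ =
      (volume {y : EuclideanSpace ℝ (Fin d) | ∀ i, |y i| ≤ 1})⁻¹ •
        volume.restrict {y : EuclideanSpace ℝ (Fin d) | ∀ i, |y i| ≤ 1}) :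
    (∫ ω, (‖U ω - Z‖ ^ 2 - ∫ ω', ‖U ω' - Z‖ ^ 2 ∂μ) ^ 3 ∂μ)
      = (16 / 15) * (‖Z‖ ^ 2 + d / 63) := by
  have hT : Measurable fun ω ↦ (U ω).ofLp := (WithLp.measurable_ofLp 2 _).comp hUm
  have hmap : Measure.map (fun ω ↦ (U ω).ofLp) μ = Measure.pi fun _ ↦ uniformIcc := by
    rw [← map_ofLp_uniform_cube, ← hU, Measure.map_map (WithLp.measurable_ofLp 2 _) hUm]
    rfl
  have transfer (f : (Fin d → ℝ) → ℝ) (hf : Continuous f) :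
      ∫ ω, f (U ω).ofLp ∂μ = ∫ y, f y ∂Measure.pi fun _ ↦ uniformIcc := by
    rw [← hmap, integral_map hT.aemeasurable hf.aestronglyMeasurable]
  have hmem (i : Fin d) {f : ℝ → ℝ} (hf : Continuous f) :
      MemLp (fun y : Fin d → ℝ ↦ f (y i)) ⊤ (Measure.pi fun _ ↦ uniformIcc) :=
    (memLp_top_uniformIcc hf).comp_measurePreserving
      (measurePreserving_eval (fun _ ↦ uniformIcc) i)
  have heval (i : Fin d) {f : ℝ → ℝ} (hf : Continuous f) :
      ∫ y : Fin d → ℝ, f (y i) ∂(Measure.pi fun _ ↦ uniformIcc) = ∫ x, f x ∂uniformIcc :=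
    integral_comp_eval (μ := fun _ ↦ uniformIcc) hf.aestronglyMeasurable
  have hmean : ∫ ω, ‖U ω - Z‖ ^ 2 ∂μ = ∑ i, (1 / 3 + Z i ^ 2) := by
    simp only [EuclideanSpace.real_norm_sq_eq, PiLp.sub_apply]
    rw [transfer (fun y ↦ ∑ i, (y i - Z i) ^ 2) (by fun_prop), integral_finsetSum _ fun i _ ↦
      (hmem i (f := fun x ↦ (x - Z i) ^ 2) (by fun_prop)).integrable le_top]
    refine Finset.sum_congr rfl fun i _ ↦ ?_
    rw [heval i (f := fun x ↦ (x - Z i) ^ 2) (by fun_prop), integral_sq_sub_uniformIcc]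
  rw [hmean]
  simp only [EuclideanSpace.real_norm_sq_eq, PiLp.sub_apply, ← Finset.sum_sub_distrib]
  rw [transfer (fun y ↦ (∑ i, ((y i - Z i) ^ 2 - (1 / 3 + Z i ^ 2))) ^ 3) (by fun_prop)]
  have hcont (i : Fin d) : Continuous fun x : ℝ ↦ (x - Z i) ^ 2 - (1 / 3 + Z i ^ 2) := by
    fun_prop
  rw [integral_sum_pow_three_of_iIndepFun
    (X := fun i (y : Fin d → ℝ) ↦ (y i - Z i) ^ 2 - (1 / 3 + Z i ^ 2))
    (ProbabilityTheory.iIndepFun_pi fun i ↦ (hcont i).aemeasurable)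
    (fun i ↦ (hmem i (hcont i)).aestronglyMeasurable.aemeasurable) (fun i ↦ hmem i (hcont i))]
  · have hthird (i : Fin d) := (heval i ((hcont i).pow 3)).trans
      (integral_centered_sq_sub_pow_three_uniformIcc (Z i))
    refine (Finset.sum_congr rfl fun i _ ↦ hthird i).trans ?_
    rw [← Finset.mul_sum, Finset.sum_add_distrib]
    simp [div_eq_mul_inv]
  · intro i
    rw [heval i (hcont i), integral_sub
      ((memLp_top_uniformIcc (by fun_prop)).integrable le_top) (integrable_const _),
      integral_sq_sub_uniformIcc]
    simp
end

section
/- Let d ≥ 1, Z = (z_1, …, z_d) ∈ ℝ^d and r > 0. Define for z ∈ ℝ the function G_z(t) by: G_z(t) = 0 for t ≤ 0; G_z(t) = t·1_{|z| ≤ 1} for 0 < t < |1 - |z||; G_z(t) = (1 - |z| + t)/2 for |1 - |z|| ≤ t ≤ 1 + |z|; and G_z(t) = 1 for t > 1 + |z|. Then the fraction of the cube C_d = [-1,1]^d covered by the cube C_d(Z, r) satisfies vol(C_d ∩ C_d(Z, r))/2^d = ∏_{j=1}^d G_{z_j}(r). -/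
open MeasureTheory

/-- Half the length of `[-1, 1] ∩ [z - t, z + t]`, by cases. -/
theorem half_length_inter_unit_interval (z t : ℝ) (ht : 0 < t) :
    max (min 1 (z + t) - max (-1) (z - t)) 0 / 2 =
      if t ≤ 0 then 0
      else if t < abs (1 - |z|) then (if |z| ≤ 1 then t else 0)
      else if t ≤ 1 + |z| then (1 - |z| + t) / 2
      else 1 := by
  rw [if_neg ht.not_ge]
  rcases abs_cases z with ⟨h, _⟩ | ⟨h, _⟩ <;> rw [h] <;>
  rcases abs_cases (1 - |z|) with ⟨h', _⟩ | ⟨h', _⟩ <;> rw [h] at h' <;> rw [h'] <;>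
  rcases max_cases (-1) (z - t) with ⟨h₁, _⟩ | ⟨h₁, _⟩ <;> rw [h₁] <;>
  rcases min_cases 1 (z + t) with ⟨h₂, _⟩ | ⟨h₂, _⟩ <;> rw [h₂] <;>
  split_ifs <;>
  first
  | rw [max_eq_left (by linarith)]; linarith
  | rw [max_eq_right (by linarith)]; linarith

/-- The cube `[-1, 1] ^ ι` meets the sup-norm ball around `Z` in a box. -/
theorem unit_cube_inter_cube_eq_pi {ι : Type*} (Z : ι → ℝ) (r : ℝ) :
    {y : ι → ℝ | ∀ i, |y i| ≤ 1} ∩ {y : ι → ℝ | ∀ i, |y i - Z i| ≤ r} =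
      Set.univ.pi fun i => Set.Icc (max (-1) (Z i - r)) (min 1 (Z i + r)) := by
  ext y
  simp only [Set.mem_inter_iff, Set.mem_ofPred_eq, Set.mem_univ_pi, Set.mem_Icc, max_le_iff,
    le_min_iff, abs_le, ← forall_and]
  refine forall_congr' fun i => ?_
  grind

/-- Let `d ≥ 1`, `Z ∈ ℝ^d`, `r > 0`, and define `G_z(t)` piecewise as in
the paper. Then the fraction of the cube `C_d = [-1,1]^d` covered by the cube (`L∞`-ball)
`C_d(Z, r) = {y : ‖y - Z‖_∞ ≤ r}` is `vol(C_d ∩ C_d(Z, r))/2^d = ∏_j G_{z_j}(r)`. -/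
theorem stmt_14 (d : ℕ) (hd : 1 ≤ d) (Z : Fin d → ℝ) (r : ℝ) (hr : 0 < r)
    (G : ℝ → ℝ → ℝ)
    (hG : ∀ z t, G z t =
      if t ≤ 0 then 0
      else if t < abs (1 - |z|) then (if |z| ≤ 1 then t else 0)
      else if t ≤ 1 + |z| then (1 - |z| + t) / 2
      else 1) :
    (volume ({y : Fin d → ℝ | ∀ i, |y i| ≤ 1}
        ∩ {y : Fin d → ℝ | ∀ i, |y i - Z i| ≤ r})).toReal / 2 ^ d
      = ∏ j, G (Z j) r := by
  rw [unit_cube_inter_cube_eq_pi, volume_pi_pi, ENNReal.toReal_prod]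
  have hpow : (2 : ℝ) ^ d = ∏ _j : Fin d, (2 : ℝ) := by simp
  rw [hpow, ← Finset.prod_div_distrib]
  refine Finset.prod_congr rfl fun j _ => ?_
  rw [hG, ← half_length_inter_unit_interval (Z j) r hr, Real.volume_Icc, ENNReal.toReal_ofReal']
end

section
/- Let 0 < δ ≤ 1, r > 0 and k ≥ 1 be an integer, and set I_k = (1/2)∫_{-1}^{1} q(u)^k du, where q(u) = P(|ζ - u| ≤ r) for ζ uniformly distributed on [-δ, δ]. If r ≤ δ and r + δ ≥ 1, then I_k = (δ - r)·(r/δ)^k - (2δ/(k+1))·( ((δ + r - 1)/(2δ))^{k+1} - (r/δ)^{k+1} ). -/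
open MeasureTheory

/-- The mass that the uniform law on `[-δ, δ]` gives to `[u - r, u + r]`, when the two
intervals meet. -/
theorem uniform_abs_sub_le_toReal {Ω : Type*} [MeasurableSpace Ω] {μ : Measure Ω}
    {ζ : Ω → ℝ} {δ r u : ℝ} (hδ : 0 < δ) (hr : 0 ≤ r) (hu : |u| ≤ r + δ) (hζm : Measurable ζ)
    (hζ : Measure.map ζ μ =
      (volume (Set.Icc (-δ) δ))⁻¹ • volume.restrict (Set.Icc (-δ) δ)) :
    (μ {ω | |ζ ω - u| ≤ r}).toReal = (min (u + r) δ - max (u - r) (-δ)) / (2 * δ) := by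
  have hpre : {ω | |ζ ω - u| ≤ r} = ζ ⁻¹' Set.Icc (u - r) (u + r) := by
    ext ω
    simp only [Set.mem_ofPred_eq, Set.mem_preimage, Set.mem_Icc, abs_le]
    constructor <;> rintro ⟨h₁, h₂⟩ <;> constructor <;> linarith
  obtain ⟨hu₁, hu₂⟩ := abs_le.mp hu
  have hmm : max (u - r) (-δ) ≤ min (u + r) δ := by
    apply max_le <;> apply le_min <;> linarith
  rw [hpre, ← Measure.map_apply hζm measurableSet_Icc, hζ, Measure.smul_apply,
    Measure.restrict_apply measurableSet_Icc, Set.Icc_inter_Icc, Real.volume_Icc,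
    Real.volume_Icc, smul_eq_mul, ENNReal.toReal_mul, ENNReal.toReal_inv,
    ENNReal.toReal_ofReal (by linarith), ENNReal.toReal_ofReal (sub_nonneg.mpr hmm)]
  rw [show δ - -δ = 2 * δ by ring, div_eq_inv_mul]

/-- The integral of a power of the affine function `u ↦ (c - u) / d`. -/
theorem integral_const_sub_div_pow (a b c : ℝ) {d : ℝ} (hd : d ≠ 0) (k : ℕ) :
    ∫ u in a..b, ((c - u) / d) ^ k =
      -(d / (k + 1)) * (((c - b) / d) ^ (k + 1) - ((c - a) / d) ^ (k + 1)) := by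
  have h := intervalIntegral.integral_comp_sub_div (a := a) (b := b) (fun x : ℝ => x ^ k) hd (c / d)
  simp only [← sub_div] at h
  rw [h, integral_pow, smul_eq_mul]
  ring

/-- Let `0 < δ ≤ 1`, `r > 0`, `k ≥ 1`, and
`I_k = (1/2)∫_{-1}^1 q(u)^k du` with `q(u) = P(|ζ - u| ≤ r)` for `ζ` uniform on `[-δ, δ]`.
If `r ≤ δ` and `r + δ ≥ 1`, then
`I_k = (δ - r)(r/δ)^k - (2δ/(k+1))·(((δ + r - 1)/(2δ))^{k+1} - (r/δ)^{k+1})`. -/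
theorem stmt_16 (δ r : ℝ) (hδ0 : 0 < δ) (hδ1 : δ ≤ 1) (hr : 0 < r)
    (k : ℕ) (hk : 1 ≤ k)
    {Ω : Type*} [MeasurableSpace Ω] (μ : Measure Ω) [IsProbabilityMeasure μ]
    (ζ : Ω → ℝ) (hζm : Measurable ζ)
    (hζ : Measure.map ζ μ =
      (volume (Set.Icc (-δ) δ))⁻¹ • volume.restrict (Set.Icc (-δ) δ))
    (q : ℝ → ℝ) (hq : ∀ u, q u = (μ {ω | |ζ ω - u| ≤ r}).toReal)
    (hrδ : r ≤ δ) (hsum : 1 ≤ r + δ) :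
    (1 / 2) * (∫ u in (-1 : ℝ)..1, (q u) ^ k)
      = (δ - r) * (r / δ) ^ k
        - (2 * δ / (k + 1)) * (((δ + r - 1) / (2 * δ)) ^ (k + 1) - (r / δ) ^ (k + 1)) := by
  set g : ℝ → ℝ := fun u => (min (u + r) δ - max (u - r) (-δ)) / (2 * δ) with hg
  have hgc : Continuous fun u => g u ^ k := by fun_prop
  have hqg : ∫ u in (-1 : ℝ)..1, q u ^ k = ∫ u in (-1 : ℝ)..1, g u ^ k := by
    refine intervalIntegral.integral_congr fun u hu => ?_
    rw [Set.uIcc_of_le (by norm_num)] at hu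
    simp only [hq u, hg]
    rw [uniform_abs_sub_le_toReal hδ0 hr.le ((abs_le.mpr hu).trans hsum) hζm hζ]
  have hge : ∀ u, g (-u) = g u := fun u => by
    simp only [hg]
    have h := min_neg_neg (u - r) (-δ)
    rw [neg_neg] at h
    rw [show -u + r = -(u - r) by ring, show -u - r = -(u + r) by ring, max_neg_neg, h]
    ring
  have hneg : ∫ u in (-1 : ℝ)..0, g u ^ k = ∫ u in (0 : ℝ)..1, g u ^ k := by
    have h := intervalIntegral.integral_comp_neg (a := 0) (b := 1) fun u => g u ^ k
    simpa only [hge, neg_zero] using h.symm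
  have hmid : ∫ u in (0 : ℝ)..(δ - r), g u ^ k = (δ - r) * (r / δ) ^ k := by
    have h : ∀ u ∈ Set.uIcc 0 (δ - r), g u ^ k = (r / δ) ^ k := fun u hu => by
      rw [Set.uIcc_of_le (by linarith)] at hu
      simp only [hg]
      rw [min_eq_left (by linarith [hu.2]), max_eq_left (by linarith [hu.1])]
      congr 1
      field_simp
      ring
    rw [intervalIntegral.integral_congr h, intervalIntegral.integral_const, smul_eq_mul, sub_zero]
  have htail : ∫ u in (δ - r)..1, g u ^ k = -(2 * δ / (k + 1)) *
      (((δ + r - 1) / (2 * δ)) ^ (k + 1) - (r / δ) ^ (k + 1)) := by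
    have h : ∀ u ∈ Set.uIcc (δ - r) 1, g u ^ k = ((δ + r - u) / (2 * δ)) ^ k := fun u hu => by
      rw [Set.uIcc_of_le (by linarith)] at hu
      simp only [hg]
      rw [min_eq_right (by linarith [hu.1]), max_eq_left (by linarith [hu.1])]
      congr 2
      ring
    rw [intervalIntegral.integral_congr h, integral_const_sub_div_pow _ _ _ (by positivity),
      show δ + r - (δ - r) = 2 * r by ring, mul_div_mul_left _ _ two_ne_zero]
  have hint : ∀ a b : ℝ, IntervalIntegrable (fun u => g u ^ k) volume a b :=
    hgc.intervalIntegrable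
  rw [hqg, ← intervalIntegral.integral_add_adjacent_intervals (hint (-1) 0) (hint 0 1), hneg,
    ← intervalIntegral.integral_add_adjacent_intervals (hint 0 (δ - r)) (hint (δ - r) 1),
    hmid, htail]
  ring
end

section
/- Let 0 < δ ≤ 1, r > 0 and k ≥ 1 be an integer, and set I_k = (1/2)∫_{-1}^{1} q(u)^k du, where q(u) = P(|ζ - u| ≤ r) for ζ uniformly distributed on [-δ, δ]. If 0 ≤ r - δ ≤ 1 and r + δ ≥ 1, then I_k = (r - δ) - (2δ/(k+1))·( ((δ + r - 1)/(2δ))^{k+1} - 1 ). -/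
open MeasureTheory

/-- The probability that a uniform variable on `[-δ, δ]` lies within `r` of `u`, as a length. -/
lemma uniform_measureReal_abs_sub_le {δ r : ℝ} (hδ0 : 0 < δ)
    {Ω : Type*} [MeasurableSpace Ω] {μ : Measure Ω} {ζ : Ω → ℝ} (hζm : Measurable ζ)
    (hζ : Measure.map ζ μ =
      (volume (Set.Icc (-δ) δ))⁻¹ • volume.restrict (Set.Icc (-δ) δ)) (u : ℝ) :
    (μ {ω | |ζ ω - u| ≤ r}).toReal = max (min (u + r) δ - max (u - r) (-δ)) 0 / (2 * δ) := by
  have hpre : {ω | |ζ ω - u| ≤ r} = ζ ⁻¹' Set.Icc (u - r) (u + r) := by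
    ext ω
    simp only [Set.mem_ofPred_eq, Set.mem_preimage, Set.mem_Icc, abs_le]
    constructor <;> rintro ⟨h1, h2⟩ <;> constructor <;> linarith
  rw [hpre, ← Measure.map_apply hζm measurableSet_Icc, hζ, Measure.smul_apply,
    Measure.restrict_apply measurableSet_Icc, Set.Icc_inter_Icc, smul_eq_mul,
    ENNReal.toReal_mul, ENNReal.toReal_inv, Real.volume_Icc, Real.volume_Icc,
    sub_neg_eq_add, ← two_mul, ENNReal.toReal_ofReal (r := 2 * δ) (by linarith),
    ENNReal.toReal_ofReal', div_eq_inv_mul]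

/-- The integral of a power of the linear slope `(c - u) / d` from `c - d` to `b`. -/
lemma integral_sub_div_pow (c d b : ℝ) (hd : d ≠ 0) (k : ℕ) :
    ∫ u in (c - d)..b, ((c - u) / d) ^ k = d / (k + 1) * (1 - ((c - b) / d) ^ (k + 1)) := by
  have h := intervalIntegral.integral_comp_sub_div (a := c - d) (b := b)
    (fun x : ℝ => x ^ k) hd (c / d)
  simp only [← sub_div] at h
  rw [h, integral_pow, sub_sub_cancel, div_self hd, one_pow, smul_eq_mul]
  ring

/-- Let `0 < δ ≤ 1`, `r > 0`, `k ≥ 1`, and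
`I_k = (1/2)∫_{-1}^1 q(u)^k du` with `q(u) = P(|ζ - u| ≤ r)` for `ζ` uniform on `[-δ, δ]`.
If `0 ≤ r - δ ≤ 1` and `r + δ ≥ 1`, then
`I_k = (r - δ) - (2δ/(k+1))·(((δ + r - 1)/(2δ))^{k+1} - 1)`. -/
theorem stmt_17 (δ r : ℝ) (hδ0 : 0 < δ) (hδ1 : δ ≤ 1) (hr : 0 < r)
    (k : ℕ) (hk : 1 ≤ k)
    {Ω : Type*} [MeasurableSpace Ω] (μ : Measure Ω) [IsProbabilityMeasure μ]
    (ζ : Ω → ℝ) (hζm : Measurable ζ)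
    (hζ : Measure.map ζ μ =
      (volume (Set.Icc (-δ) δ))⁻¹ • volume.restrict (Set.Icc (-δ) δ))
    (q : ℝ → ℝ) (hq : ∀ u, q u = (μ {ω | |ζ ω - u| ≤ r}).toReal)
    (hrδ : 0 ≤ r - δ) (hrδ1 : r - δ ≤ 1) (hsum : 1 ≤ r + δ) :
    (1 / 2) * (∫ u in (-1 : ℝ)..1, (q u) ^ k)
      = (r - δ)
        - (2 * δ / (k + 1)) * (((δ + r - 1) / (2 * δ)) ^ (k + 1) - 1) := by
  have hd : 2 * δ ≠ 0 := by positivity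
  have hqv u := (hq u).trans (uniform_measureReal_abs_sub_le hδ0 hζm hζ u)
  have hmid : ∀ u ∈ Set.uIcc (-(r - δ)) (r - δ), q u ^ k = 1 := by
    intro u hu
    rw [Set.uIcc_of_le (by linarith), Set.mem_Icc] at hu
    rw [hqv, min_eq_right (by linarith), max_eq_right (a := u - r) (by linarith),
      max_eq_left (by linarith), sub_neg_eq_add, ← two_mul, div_self hd, one_pow]
  have hright : ∀ u ∈ Set.uIcc (r - δ) 1, q u ^ k = ((δ + r - u) / (2 * δ)) ^ k := by
    intro u hu
    rw [Set.uIcc_of_le hrδ1, Set.mem_Icc] at hu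
    rw [hqv, min_eq_right (by linarith), max_eq_left (a := u - r) (by linarith),
      max_eq_left (by linarith)]
    ring_nf
  have hleft : ∀ u ∈ Set.uIcc (-1) (-(r - δ)), q u ^ k = ((δ + r - -u) / (2 * δ)) ^ k := by
    intro u hu
    rw [Set.uIcc_of_le (by linarith), Set.mem_Icc] at hu
    rw [hqv, min_eq_left (by linarith), max_eq_right (a := u - r) (by linarith),
      max_eq_left (by linarith)]
    ring_nf
  have hcont : Continuous fun u => q u ^ k := by
    simp only [hqv]
    fun_prop
  have hi a b : IntervalIntegrable (fun u => q u ^ k) volume a b := hcont.intervalIntegrable a b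
  have hslope : ∫ u in (r - δ)..1, ((δ + r - u) / (2 * δ)) ^ k
      = 2 * δ / (k + 1) * (1 - ((δ + r - 1) / (2 * δ)) ^ (k + 1)) := by
    rw [← integral_sub_div_pow _ _ _ hd]
    congr 1
    ring
  rw [← intervalIntegral.integral_add_adjacent_intervals (hi (-1) (-(r - δ))) (hi _ 1),
    ← intervalIntegral.integral_add_adjacent_intervals (hi (-(r - δ)) (r - δ)) (hi _ 1),
    intervalIntegral.integral_congr hleft, intervalIntegral.integral_congr hmid,
    intervalIntegral.integral_congr hright,
    intervalIntegral.integral_comp_neg (fun u => ((δ + r - u) / (2 * δ)) ^ k),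
    neg_neg, neg_neg, hslope, intervalIntegral.integral_const, smul_eq_mul]
  ring
end
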